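/- arXiv:1009.3479 — 4 statements merged into one kernel-verified Lean document; each statement's English description precedes it below -/
import Mathlib

section
/- Let κ ∈ ℝ, σ ≠ 0 and γ ≠ 0 be real constants with discriminant q := κ² − 2σ²γ satisfying q > 0 and √q > κ. Define b(s) := 2γ(e^{√q s} − 1) / ((√q − κ)(e^{√q s} − 1) + 2√q) for s ≥ 0. Then: (i) the denominator (√q − κ)(e^{√q s} − 1) + 2√q is strictly positive for every s ≥ 0, so b is well-defined on [0,∞); (ii) b(0) = 0; (iii) b is differentiable and satisfies the Riccati equation b′(s) = κ b(s) + ½σ² b(s)² + γ for every s ≥ 0; (iv) for every s > 0, b(s) has the same strict sign as γ; (v) b is strictly increasing if γ > 0 and strictly decreasing if γ < 0; (vi) b is bounded, with |b(s)| ≤ 2|γ|/(√q − κ) for all s ≥ 0. -/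
/-- Properties of the normal solution
`b(s) = 2γ(e^{√q s} − 1) / ((√q − κ)(e^{√q s} − 1) + 2√q)` of the Riccati equation
`b′ = κ b + ½σ² b² + γ`, `b(0) = 0`, when `q := κ² − 2σ²γ > 0` and `√q > κ`:
positive denominator, initial condition, the ODE, strict sign of `b(s)` for `s > 0`
matching the sign of `γ`, strict monotonicity, and the bound `|b(s)| ≤ 2|γ|/(√q − κ)`. -/
theorem stmt3 (κ σ γ : ℝ) (hσ : σ ≠ 0) (hγ : γ ≠ 0)
    (q : ℝ) (hq : q = κ ^ 2 - 2 * σ ^ 2 * γ) (hqpos : 0 < q)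
    (hκ : κ < Real.sqrt q)
    (b : ℝ → ℝ)
    (hb : ∀ s : ℝ, b s =
      2 * γ * (Real.exp (Real.sqrt q * s) - 1) /
        ((Real.sqrt q - κ) * (Real.exp (Real.sqrt q * s) - 1) + 2 * Real.sqrt q)) :
    (∀ s ≥ (0 : ℝ),
        0 < (Real.sqrt q - κ) * (Real.exp (Real.sqrt q * s) - 1) + 2 * Real.sqrt q)
    ∧ b 0 = 0
    ∧ (∀ s ≥ (0 : ℝ), HasDerivAt b (κ * b s + σ ^ 2 / 2 * (b s) ^ 2 + γ) s)
    ∧ (∀ s > (0 : ℝ), (0 < γ → 0 < b s) ∧ (γ < 0 → b s < 0))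
    ∧ (0 < γ → StrictMonoOn b (Set.Ici 0))
    ∧ (γ < 0 → StrictAntiOn b (Set.Ici 0))
    ∧ (∀ s ≥ (0 : ℝ), |b s| ≤ 2 * |γ| / (Real.sqrt q - κ)) := by
  set r := Real.sqrt q
  have hr0 : 0 < r := Real.sqrt_pos.mpr hqpos
  have hrκ : 0 < r - κ := sub_pos.mpr hκ
  have hr2 : r ^ 2 = κ ^ 2 - 2 * σ ^ 2 * γ := (Real.sq_sqrt hqpos.le).trans hq
  have hmono : ∀ x y : ℝ, x < y → Real.exp (r * x) < Real.exp (r * y) := fun x y h =>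
    Real.exp_lt_exp.mpr (mul_lt_mul_of_pos_left h hr0)
  have hu : ∀ s ≥ (0 : ℝ), 0 ≤ Real.exp (r * s) - 1 := fun s hs =>
    sub_nonneg.mpr (Real.one_le_exp (mul_nonneg hr0.le hs))
  have hD : ∀ s ≥ (0 : ℝ), 0 < (r - κ) * (Real.exp (r * s) - 1) + 2 * r := fun s hs => by
    have := mul_nonneg hrκ.le (hu s hs)
    linarith
  have hb0 : b 0 = 0 := by simp [hb]
  have hinc : 0 < γ → StrictMonoOn b (Set.Ici 0) := fun hg x hx y hy hxy => by
    rw [hb x, hb y, div_lt_div_iff₀ (hD x hx) (hD y hy)]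
    linear_combination 4 * mul_pos (mul_pos hg hr0) (sub_pos.mpr (hmono x y hxy))
  have hdec : γ < 0 → StrictAntiOn b (Set.Ici 0) := fun hg x hx y hy hxy => by
    rw [hb x, hb y, div_lt_div_iff₀ (hD y hy) (hD x hx)]
    linear_combination
      4 * mul_pos (mul_pos (neg_pos.mpr hg) hr0) (sub_pos.mpr (hmono x y hxy))
  refine ⟨hD, hb0, fun s hs => ?_, fun s hs => ⟨fun hg => ?_, fun hg => ?_⟩, hinc, hdec,
    fun s hs => ?_⟩
  · have hne := (hD s hs).ne'
    have hE : HasDerivAt (fun t : ℝ => Real.exp (r * t) - 1) (Real.exp (r * s) * r) s := by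
      simpa using (((hasDerivAt_id s).const_mul r).exp).sub_const 1
    have hquot := (hE.const_mul (2 * γ)).fun_div ((hE.const_mul (r - κ)).add_const (2 * r)) hne
    rw [funext hb]
    refine hquot.congr_deriv ?_
    beta_reduce
    generalize Real.exp (r * s) = E at hne ⊢
    field_simp
    linear_combination -(E - 1) ^ 2 * hr2
  · simpa [hb0] using hinc hg Set.self_mem_Ici (Set.mem_Ici.mpr hs.le) hs
  · simpa [hb0] using hdec hg Set.self_mem_Ici (Set.mem_Ici.mpr hs.le) hs
  · rw [hb, abs_div, abs_mul, abs_mul, abs_of_pos (hD s hs), abs_of_nonneg (hu s hs), abs_two,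
      div_le_div_iff₀ (hD s hs) hrκ]
    linear_combination 4 * mul_nonneg (abs_nonneg γ) hr0.le
end

section
/- Let I ≥ 1, τ_i > 0, β_i ∈ ℝ (i = 1,…,I), τ_Σ := Σ_i τ_i, σ_ℰ ∈ ℝ, κ_ℰ ∈ ℝ, κ_v ∈ ℝ, σ_v < 0, and U > 0. Set κ := κ_v − (σ_ℰ/τ_Σ)σ_v, γ := (1/τ_Σ)(Σ_i β_i²/(2τ_i) + σ_ℰ²/(2τ_Σ) − κ_ℰ) and γ_rep := (1/τ_Σ)((1/(2τ_Σ))Σ_i β_i² + σ_ℰ²/(2τ_Σ) − κ_ℰ). Suppose b, b_rep : [0, U] → ℝ are differentiable with b(0) = b_rep(0) = 0, b′(s) = κ b(s) + ½σ_v² b(s)² + γ and b_rep′(s) = κ b_rep(s) + ½σ_v² b_rep(s)² + γ_rep on [0, U]. Then for every t ∈ [0, U], σ_ℰ/τ_Σ − b(U − t)σ_v ≥ σ_ℰ/τ_Σ − b_rep(U − t)σ_v; that is, with countercyclical income volatility (σ_v < 0), the incomplete-market discrete market price of risk coefficient μ_S^dis(t) := σ_ℰ/τ_Σ − b(U − t)σ_v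 dominates the representative-agent coefficient μ_S^{dis,rep}(t) := σ_ℰ/τ_Σ − b_rep(U − t)σ_v. -/
/-- A function that starts nonpositive and grows at most at a linear rate while it is positive
stays nonpositive. -/
theorem nonpos_of_deriv_right_le_mul {d d' : ℝ → ℝ} {u v K : ℝ}
    (hd : ContinuousOn d (Set.Icc u v))
    (hd' : ∀ s ∈ Set.Ico u v, HasDerivWithinAt d (d' s) (Set.Ici s) s)
    (hu : d u ≤ 0) (hK : ∀ s ∈ Set.Ico u v, 0 < d s → d' s ≤ K * d s) :
    ∀ s ∈ Set.Icc u v, d s ≤ 0 := by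
  intro s hs
  have barrier : ∀ ε > 0, d s ≤ ε * Real.exp ((K + 1) * s) := by
    intro ε hε
    refine image_le_of_deriv_right_lt_deriv_boundary (f' := d')
      (B := fun x => ε * Real.exp ((K + 1) * x))
      (B' := fun x => ε * (Real.exp ((K + 1) * x) * (K + 1))) hd hd'
      (hu.trans (by positivity)) (fun x => ?_) (fun x hx hxd => ?_) hs
    · simpa using (((hasDerivAt_id x).const_mul (K + 1)).exp.const_mul ε)
    · have hpos : 0 < ε * Real.exp ((K + 1) * x) := by positivity
      have hle := hK x hx (hxd ▸ hpos)
      rw [hxd] at hle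
      linarith
  refine le_of_forall_pos_le_add fun δ hδ => ?_
  have h := barrier (δ / Real.exp ((K + 1) * s)) (by positivity)
  rwa [div_mul_cancel₀ _ (Real.exp_pos _).ne', ← zero_add δ] at h

/-- Solutions of scalar Riccati equations are monotone in the constant term. -/
theorem riccati_le_riccati {f g : ℝ → ℝ} {k q c₁ c₂ U : ℝ} (hc : c₁ ≤ c₂) (h0 : f 0 ≤ g 0)
    (hf : ∀ s ∈ Set.Icc (0 : ℝ) U,
      HasDerivWithinAt f (k * f s + q * (f s) ^ 2 + c₁) (Set.Icc 0 U) s)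
    (hg : ∀ s ∈ Set.Icc (0 : ℝ) U,
      HasDerivWithinAt g (k * g s + q * (g s) ^ 2 + c₂) (Set.Icc 0 U) s) :
    ∀ s ∈ Set.Icc (0 : ℝ) U, f s ≤ g s := by
  have hfc : ContinuousOn f (Set.Icc 0 U) := fun s hs => (hf s hs).continuousWithinAt
  have hgc : ContinuousOn g (Set.Icc 0 U) := fun s hs => (hg s hs).continuousWithinAt
  obtain ⟨K, hK⟩ := isCompact_Icc.bddAbove_image
    (continuousOn_const.add (continuousOn_const.mul (hfc.add hgc)) :
      ContinuousOn (fun s => k + q * (f s + g s)) (Set.Icc 0 U))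
  have key := nonpos_of_deriv_right_le_mul (K := K) (hfc.sub hgc)
    (fun s hs => ((hf s ⟨hs.1, hs.2.le⟩).sub (hg s ⟨hs.1, hs.2.le⟩)).mono_of_mem_nhdsWithin
      (Icc_mem_nhdsGE_of_mem hs))
    (sub_nonpos.2 h0) (fun s hs hpos => ?_)
  · exact fun s hs => sub_nonpos.1 (key s hs)
  · have hs' : k + q * (f s + g s) ≤ K := hK ⟨s, ⟨hs.1, hs.2.le⟩, rfl⟩
    simp only [Pi.sub_apply] at hpos ⊢
    linarith [mul_le_mul_of_nonneg_right hs' hpos.le]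

theorem sum_sq_div_total_le {ι : Type*} [Fintype ι] (τ β : ι → ℝ) (hτ : ∀ i, 0 < τ i) :
    (1 / (2 * ∑ i, τ i)) * ∑ i, (β i) ^ 2 ≤ ∑ i, (β i) ^ 2 / (2 * τ i) := by
  rw [Finset.mul_sum]
  refine Finset.sum_le_sum fun i _ => ?_
  rw [one_div_mul_eq_div]
  have hi : τ i ≤ ∑ j, τ j :=
    Finset.single_le_sum (fun j _ => (hτ j).le) (Finset.mem_univ i)
  have := hτ i
  gcongr

/-- With countercyclical income volatility (`σ_v < 0`), the
incomplete-market discrete market price of risk coefficient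
`μ_S^dis(t) = σ_ℰ/τ_Σ − b(U − t)σ_v` dominates the representative-agent coefficient
`μ_S^{dis,rep}(t) = σ_ℰ/τ_Σ − b_rep(U − t)σ_v` for all `t ∈ [0, U]`, where `b` and
`b_rep` solve the Riccati equations with constant terms `γ` and `γ_rep` respectively. -/
theorem stmt7 (I : ℕ) (hI : 1 ≤ I) (τ β : Fin I → ℝ) (hτ : ∀ i, 0 < τ i)
    (τSum σℰ κℰ κv σv U : ℝ) (hτSum : τSum = ∑ i, τ i) (hσv : σv < 0) (hU : 0 < U)
    (κ γ γrep : ℝ)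
    (hκ : κ = κv - (σℰ / τSum) * σv)
    (hγ : γ = (1 / τSum) * ((∑ i, (β i) ^ 2 / (2 * τ i)) + σℰ ^ 2 / (2 * τSum) - κℰ))
    (hγrep : γrep = (1 / τSum) *
      ((1 / (2 * τSum)) * (∑ i, (β i) ^ 2) + σℰ ^ 2 / (2 * τSum) - κℰ))
    (b brep : ℝ → ℝ) (hb0 : b 0 = 0) (hbrep0 : brep 0 = 0)
    (hb : ∀ s ∈ Set.Icc (0 : ℝ) U,
      HasDerivWithinAt b (κ * b s + σv ^ 2 / 2 * (b s) ^ 2 + γ) (Set.Icc 0 U) s)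
    (hbrep : ∀ s ∈ Set.Icc (0 : ℝ) U,
      HasDerivWithinAt brep (κ * brep s + σv ^ 2 / 2 * (brep s) ^ 2 + γrep)
        (Set.Icc 0 U) s) :
    ∀ t ∈ Set.Icc (0 : ℝ) U,
      σℰ / τSum - brep (U - t) * σv ≤ σℰ / τSum - b (U - t) * σv := by
  have hτpos : 0 ≤ τSum := hτSum ▸ Finset.sum_nonneg fun i _ => (hτ i).le
  have hγle : γrep ≤ γ := by
    have := sum_sq_div_total_le τ β hτ
    rw [← hτSum] at this
    rw [hγ, hγrep]
    gcongr
  intro t ht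
  have hle := riccati_le_riccati hγle (hbrep0.trans hb0.symm).le hbrep hb (U - t)
    ⟨sub_nonneg.2 ht.2, sub_le_self U ht.1⟩
  exact sub_le_sub_left (mul_le_mul_of_nonpos_right hle hσv.le) _
end

section
/- Let I ≥ 1, τ_i > 0, β_i ∈ ℝ (i = 1,…,I), τ_Σ := Σ_i τ_i, and μ_ℰ, κ_ℰ, σ_ℰ ∈ ℝ. Define, for v ∈ ℝ, the incomplete-market spot rate r(v) := (1/τ_Σ)[μ_ℰ + (κ_ℰ − ½Σ_i β_i²/τ_i − σ_ℰ²/(2τ_Σ))v] and the representative-agent spot rate r_rep(v) := (1/τ_Σ)[μ_ℰ + (κ_ℰ − (1/(2τ_Σ))(Σ_i β_i² + σ_ℰ²))v]. Then r_rep(v) − r(v) = (1/(2τ_Σ))(Σ_i β_i²/τ_i − (1/τ_Σ)Σ_i β_i²) v, and r_rep(v) ≥ r(v) whenever v ≥ 0. -/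
/-- The representative-agent spot rate minus the incomplete-market
spot rate equals `(1/(2τSum))(∑ β i²/τ i − (1/τSum)∑ β i²) v`, and the representative-agent
rate dominates whenever the volatility state `v` is nonnegative. -/
theorem stmt8 (I : ℕ) (hI : 1 ≤ I) (τ β : Fin I → ℝ) (hτ : ∀ i, 0 < τ i)
    (τSum μℰ κℰ σℰ : ℝ) (hτSum : τSum = ∑ i, τ i)
    (r rrep : ℝ → ℝ)
    (hr : ∀ v : ℝ, r v = (1 / τSum) *
      (μℰ + (κℰ - (1 / 2) * (∑ i, (β i) ^ 2 / τ i) - σℰ ^ 2 / (2 * τSum)) * v))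
    (hrrep : ∀ v : ℝ, rrep v = (1 / τSum) *
      (μℰ + (κℰ - (1 / (2 * τSum)) * ((∑ i, (β i) ^ 2) + σℰ ^ 2)) * v)) :
    (∀ v : ℝ, rrep v - r v =
      (1 / (2 * τSum)) * ((∑ i, (β i) ^ 2 / τ i) - (1 / τSum) * ∑ i, (β i) ^ 2) * v)
    ∧ ∀ v ≥ (0 : ℝ), r v ≤ rrep v := by
  have diff_eq : ∀ v : ℝ, rrep v - r v =
      (1 / (2 * τSum)) * ((∑ i, (β i) ^ 2 / τ i) - (1 / τSum) * ∑ i, (β i) ^ 2) * v := by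
    intro v
    rw [hr, hrrep]
    ring
  refine ⟨diff_eq, fun v hv => ?_⟩
  have le_total : ∀ i, τ i ≤ τSum := fun i =>
    hτSum ▸ Finset.single_le_sum (fun j _ => (hτ j).le) (Finset.mem_univ i)
  have total_pos : 0 < τSum := (hτ ⟨0, hI⟩).trans_le (le_total _)
  have sum_le : (1 / τSum) * ∑ i, (β i) ^ 2 ≤ ∑ i, (β i) ^ 2 / τ i := by
    rw [one_div_mul_eq_div, Finset.sum_div]
    exact Finset.sum_le_sum fun i _ =>
      div_le_div_of_nonneg_left (sq_nonneg _) (hτ i) (le_total i)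
  rw [← sub_nonneg, diff_eq]
  exact mul_nonneg (mul_nonneg (by positivity) (sub_nonneg.mpr sum_le)) hv
end

section
/- Let 0 ≤ t < T, v > 0 and σ_v < 0. Let b, b_rep, a, a_rep : [0, T − t] → ℝ be continuous functions such that b_rep(s) > 0 and b_rep(s) ≤ b(s) and a(s) ≤ a_rep(s) for all s ∈ (0, T − t]. Then σ_v √v ∫_t^T exp(b(U − t)v − a(U − t)) b(U − t) dU ≤ σ_v √v ∫_t^T exp(b_rep(U − t)v − a_rep(U − t)) b_rep(U − t) dU < 0; that is, the incomplete-market annuity volatility coefficient σ_{St} is more negative than the representative-agent annuity volatility coefficient σ_{St}^rep, and both are strictly negative. -/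
/-- The integrand `U ↦ B(t,U) b(U - t)` of the annuity volatility is continuous on `[t, T]`. -/
theorem continuousOn_exp_affine_mul {t T v : ℝ} {b a : ℝ → ℝ}
    (hb : ContinuousOn b (Set.Icc 0 (T - t))) (ha : ContinuousOn a (Set.Icc 0 (T - t))) :
    ContinuousOn (fun U => Real.exp (b (U - t) * v - a (U - t)) * b (U - t)) (Set.Icc t T) := by
  have hmaps : Set.MapsTo (fun U : ℝ => U - t) (Set.Icc t T) (Set.Icc 0 (T - t)) :=
    fun U hU => ⟨sub_nonneg.2 hU.1, sub_le_sub_right hU.2 t⟩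
  have hsub : ContinuousOn (fun U : ℝ => U - t) (Set.Icc t T) := by fun_prop
  have hb' := hb.comp hsub hmaps
  exact (((hb'.mul continuousOn_const).sub (ha.comp hsub hmaps)).rexp).mul hb'

/-- With countercyclical income volatility (`σ_v < 0`), `v > 0`,
`0 < b_rep ≤ b` and `a ≤ a_rep` on `(0, T − t]`, the incomplete-market annuity
volatility coefficient `σ_{St} = σ_v √v ∫_t^T exp(b(U−t)v − a(U−t)) b(U−t) dU` is
more negative than the representative-agent coefficient
`σ_{St}^rep = σ_v √v ∫_t^T exp(b_rep(U−t)v − a_rep(U−t)) b_rep(U−t) dU`, and both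
are strictly negative. -/
theorem stmt13 (t T v σv : ℝ) (ht : 0 ≤ t) (htT : t < T) (hv : 0 < v) (hσv : σv < 0)
    (b brep a arep : ℝ → ℝ)
    (hbc : ContinuousOn b (Set.Icc 0 (T - t)))
    (hbrepc : ContinuousOn brep (Set.Icc 0 (T - t)))
    (hac : ContinuousOn a (Set.Icc 0 (T - t)))
    (harepc : ContinuousOn arep (Set.Icc 0 (T - t)))
    (hbreppos : ∀ s ∈ Set.Ioc (0 : ℝ) (T - t), 0 < brep s)
    (hble : ∀ s ∈ Set.Ioc (0 : ℝ) (T - t), brep s ≤ b s)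
    (hale : ∀ s ∈ Set.Ioc (0 : ℝ) (T - t), a s ≤ arep s) :
    (σv * Real.sqrt v *
        ∫ U in t..T, Real.exp (b (U - t) * v - a (U - t)) * b (U - t))
      ≤ σv * Real.sqrt v *
        ∫ U in t..T, Real.exp (brep (U - t) * v - arep (U - t)) * brep (U - t)
    ∧ σv * Real.sqrt v *
        (∫ U in t..T, Real.exp (brep (U - t) * v - arep (U - t)) * brep (U - t))
      < 0 := by
  have hcoef : σv * Real.sqrt v < 0 := mul_neg_of_neg_of_pos hσv (Real.sqrt_pos.2 hv)
  have hint := (continuousOn_exp_affine_mul (v := v) hbc hac).intervalIntegrable_of_Icc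
    (μ := MeasureTheory.volume) htT.le
  have hintrep := (continuousOn_exp_affine_mul (v := v) hbrepc harepc).intervalIntegrable_of_Icc
    (μ := MeasureTheory.volume) htT.le
  have hmem : ∀ U ∈ Set.Ioo t T, U - t ∈ Set.Ioc 0 (T - t) :=
    fun U hU => ⟨sub_pos.2 hU.1, sub_le_sub_right hU.2.le t⟩
  refine ⟨mul_le_mul_of_nonpos_left ?_ hcoef.le, mul_neg_of_neg_of_pos hcoef ?_⟩
  · refine intervalIntegral.integral_mono_on_of_le_Ioo htT.le hintrep hint fun U hU => ?_
    have hs := hmem U hU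
    have hpos := hbreppos _ hs
    have hb := hble _ hs
    have ha := hale _ hs
    gcongr
  · exact intervalIntegral.intervalIntegral_pos_of_pos_on hintrep
      (fun U hU => mul_pos (Real.exp_pos _) (hbreppos _ (hmem U hU))) htT
end
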